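/- Let n ≥ 1, let Ω ⊆ ℝⁿ be a nonempty open connected set, and let u : Ω → ℝ be a smooth solution of the Lagrangian shrinker potential equation ∑_{i=1}^n arctan λ_i(x) = (1/2) x·∇u(x) − u(x) on Ω, where λ_1(x), …, λ_n(x) are the eigenvalues of D²u(x). Assume that for every boundary point z ∈ ∂Ω, ‖∇u(x)‖ tends to +∞ as x → z within Ω. Then the Lagrangian angle Θ(x) = (1/2) x·∇u(x) − u(x) is constant on Ω. -/

import Mathlib

/-- The `i`-th partial derivative of `u : ℝⁿ → ℝ` at `x`. -/
noncomputable def pd {n : ℕ} (u : EuclideanSpace ℝ (Fin n) → ℝ) (i : Fin n)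
    (x : EuclideanSpace ℝ (Fin n)) : ℝ :=
  fderiv ℝ u x (EuclideanSpace.single i 1)

/-- The second partial derivative `∂²_{ij} u` at `x`. -/
noncomputable def pd2 {n : ℕ} (u : EuclideanSpace ℝ (Fin n) → ℝ) (i j : Fin n)
    (x : EuclideanSpace ℝ (Fin n)) : ℝ :=
  pd (fun y => pd u j y) i x

/-- The Hessian matrix `D²u(x)`. -/
noncomputable def hessM {n : ℕ} (u : EuclideanSpace ℝ (Fin n) → ℝ)
    (x : EuclideanSpace ℝ (Fin n)) : Matrix (Fin n) (Fin n) ℝ :=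
  Matrix.of fun i j => pd2 u i j x

section Helpers

open Filter Topology Set
open scoped ContDiff

section Calculus

variable {n : ℕ} {f g : EuclideanSpace ℝ (Fin n) → ℝ} {Ω : Set (EuclideanSpace ℝ (Fin n))}
  {x : EuclideanSpace ℝ (Fin n)}

lemma fderiv_apply_eq_sum_pd (f : EuclideanSpace ℝ (Fin n) → ℝ)
    (x v : EuclideanSpace ℝ (Fin n)) : fderiv ℝ f x v = ∑ i, v i * pd f i x := by
  have hv : v = ∑ i, v i • EuclideanSpace.single i (1 : ℝ) := by
    ext j
    simp [Pi.single_apply]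
  conv_lhs => rw [hv]
  simp [pd]

lemma hasDerivAt_line (v : EuclideanSpace ℝ (Fin n)) (t : ℝ)
    (hf : DifferentiableAt ℝ f (x + t • v)) :
    HasDerivAt (fun s : ℝ => f (x + s • v)) (∑ i, v i * pd f i (x + t • v)) t := by
  rw [← fderiv_apply_eq_sum_pd]
  have h : HasDerivAt (fun s : ℝ => x + s • v) v t := by
    simpa using ((hasDerivAt_id t).smul_const v).const_add x
  exact hf.hasFDerivAt.comp_hasDerivAt t h

lemma pd_add (i : Fin n) (hf : DifferentiableAt ℝ f x) (hg : DifferentiableAt ℝ g x) :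
    pd (fun y => f y + g y) i x = pd f i x + pd g i x := by
  simp [pd, fderiv_fun_add hf hg]

lemma pd_sub (i : Fin n) (hf : DifferentiableAt ℝ f x) (hg : DifferentiableAt ℝ g x) :
    pd (fun y => f y - g y) i x = pd f i x - pd g i x := by
  simp [pd, fderiv_fun_sub hf hg]

lemma pd_mul (i : Fin n) (hf : DifferentiableAt ℝ f x) (hg : DifferentiableAt ℝ g x) :
    pd (fun y => f y * g y) i x = f x * pd g i x + g x * pd f i x := by
  simp [pd, fderiv_fun_mul hf hg]

lemma pd_const_mul (i : Fin n) (c : ℝ) (hf : DifferentiableAt ℝ f x) :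
    pd (fun y => c * f y) i x = c * pd f i x := by
  simp [pd, fderiv_const_mul hf]

lemma pd_sum {ι : Type*} (s : Finset ι) {F : ι → EuclideanSpace ℝ (Fin n) → ℝ} (i : Fin n)
    (hF : ∀ k ∈ s, DifferentiableAt ℝ (F k) x) :
    pd (fun y => ∑ k ∈ s, F k y) i x = ∑ k ∈ s, pd (F k) i x := by
  simp [pd, fderiv_fun_sum hF]

lemma pd_const (i : Fin n) (c : ℝ) : pd (fun _ => c) i x = 0 := by
  simp [pd]

lemma pd_coord (i j : Fin n) :
    pd (fun y : EuclideanSpace ℝ (Fin n) => y j) i x = if i = j then 1 else 0 := by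
  have h : HasFDerivAt (fun y : EuclideanSpace ℝ (Fin n) => y j)
      (EuclideanSpace.proj j : EuclideanSpace ℝ (Fin n) →L[ℝ] ℝ) x :=
    (EuclideanSpace.proj j : EuclideanSpace ℝ (Fin n) →L[ℝ] ℝ).hasFDerivAt
  simp [pd, h.fderiv, eq_comm]

lemma pd_exp (i : Fin n) (hf : DifferentiableAt ℝ f x) :
    pd (fun y => Real.exp (f y)) i x = Real.exp (f x) * pd f i x := by
  simp [pd, fderiv_exp hf]

lemma pd_congr (hΩ : IsOpen Ω) (hx : x ∈ Ω) (h : ∀ y ∈ Ω, f y = g y) (i : Fin n) :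
    pd f i x = pd g i x := by
  have : f =ᶠ[𝓝 x] g := by
    filter_upwards [hΩ.mem_nhds hx] with y hy using h y hy
  simp [pd, this.fderiv_eq]

lemma contDiff_coord (j : Fin n) : ContDiff ℝ ∞ (fun y : EuclideanSpace ℝ (Fin n) => y j) :=
  (EuclideanSpace.proj j : EuclideanSpace ℝ (Fin n) →L[ℝ] ℝ).contDiff

lemma ContDiffOn.pd (hf : ContDiffOn ℝ ∞ f Ω) (hΩ : IsOpen Ω) (i : Fin n) :
    ContDiffOn ℝ ∞ (pd f i) Ω :=
  (hf.fderiv_of_isOpen hΩ (by simp)).clm_apply contDiffOn_const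

lemma ContDiffOn.differentiableAt_of_mem (hf : ContDiffOn ℝ ∞ f Ω) (hΩ : IsOpen Ω) (hx : x ∈ Ω) :
    DifferentiableAt ℝ f x :=
  (hf.contDiffAt (hΩ.mem_nhds hx)).differentiableAt (by simp)

lemma pd2_comm (hf : ContDiffOn ℝ ∞ f Ω) (hΩ : IsOpen Ω) (hx : x ∈ Ω) (i j : Fin n) :
    pd2 f i j x = pd2 f j i x := by
  have hd : DifferentiableAt ℝ (fderiv ℝ f) x :=
    (((hf.fderiv_of_isOpen hΩ (m := ∞) (by simp))).contDiffAt (hΩ.mem_nhds hx)).differentiableAt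
      (by simp)
  have key (i j : Fin n) : pd2 f i j x =
      fderiv ℝ (fderiv ℝ f) x (EuclideanSpace.single i 1) (EuclideanSpace.single j 1) := by
    simp only [pd2, pd]
    rw [fderiv_clm_apply hd (by fun_prop)]
    simp
  rw [key, key]
  exact (hf.contDiffAt (hΩ.mem_nhds hx)).isSymmSndFDerivAt
    (by simpa using (ENat.LEInfty.out : (2 : ℕ∞ω) ≤ ∞)) _ _

lemma pd2_add_const_mul (hf : ContDiffOn ℝ ∞ f Ω) (hg : ContDiffOn ℝ ∞ g Ω) (hΩ : IsOpen Ω)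
    (hx : x ∈ Ω) (c : ℝ) (i j : Fin n) :
    pd2 (fun y => f y + c * g y) i j x = pd2 f i j x + c * pd2 g i j x := by
  have h1 : ∀ y ∈ Ω, pd (fun y => f y + c * g y) j y = pd f j y + c * pd g j y := by
    intro y hy
    have hgy := hg.differentiableAt_of_mem hΩ hy
    rw [pd_add j (hf.differentiableAt_of_mem hΩ hy) (hgy.const_mul c), pd_const_mul j c hgy]
  have hgx := (hg.pd hΩ j).differentiableAt_of_mem hΩ hx
  rw [pd2, pd_congr hΩ hx h1, pd_add i ((hf.pd hΩ j).differentiableAt_of_mem hΩ hx)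
    (hgx.const_mul c), pd_const_mul i c hgx]
  rfl

lemma IsLocalMax.pd_eq_zero (h : IsLocalMax f x) (i : Fin n) : pd f i x = 0 := by
  simp [pd, h.fderiv_eq_zero]

lemma IsLocalMax.sum_pd2_nonpos (hf : ContDiffOn ℝ ∞ f Ω) (hΩ : IsOpen Ω) (hx : x ∈ Ω)
    (h : IsLocalMax f x) (v : EuclideanSpace ℝ (Fin n)) :
    ∑ i, ∑ j, v i * v j * pd2 f i j x ≤ 0 := by
  have hc : Continuous fun s : ℝ => x + s • v := by fun_prop
  have h0 : x + (0 : ℝ) • v = x := by simp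
  have hmem : ∀ᶠ s : ℝ in 𝓝 0, x + s • v ∈ Ω :=
    hc.continuousAt.eventually_mem (by rw [h0]; exact hΩ.mem_nhds hx)
  have hd1 : deriv (fun s : ℝ => f (x + s • v)) =ᶠ[𝓝 0]
      fun s => ∑ j, v j * pd f j (x + s • v) := by
    filter_upwards [hmem] with s hs
    exact (hasDerivAt_line v s (hf.differentiableAt_of_mem hΩ hs)).deriv
  have hd2 : deriv (deriv (fun s : ℝ => f (x + s • v))) 0 =
      ∑ i, ∑ j, v i * v j * pd2 f i j x := by
    rw [hd1.deriv_eq]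
    have hs := HasDerivAt.fun_sum (u := Finset.univ) fun j _ =>
      (hasDerivAt_line (x := x) v 0
        (by rw [h0]; exact (hf.pd hΩ j).differentiableAt_of_mem hΩ hx)).const_mul (v j)
    rw [hs.deriv, Finset.sum_comm]
    simp only [h0, Finset.mul_sum, pd2]
    exact Finset.sum_congr rfl fun j _ => Finset.sum_congr rfl fun i _ => by ring
  by_contra! hpos
  have hmax : IsLocalMax (fun s : ℝ => f (x + s • v)) 0 := by
    have : Tendsto (fun s : ℝ => x + s • v) (𝓝 0) (𝓝 x) := by
      simpa using hc.tendsto 0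
    simpa [IsLocalMax, IsMaxFilter] using this.eventually h
  have hmin := isLocalMin_of_deriv_deriv_pos (hd2 ▸ hpos) hmax.deriv_eq_zero
    (hasDerivAt_line v 0
      (by rw [h0]; exact hf.differentiableAt_of_mem hΩ hx)).continuousAt
  have hconst : (fun s : ℝ => f (x + s • v)) =ᶠ[𝓝 0] fun _ => f (x + (0 : ℝ) • v) := by
    filter_upwards [hmax, hmin] with s h1 h2 using le_antisymm h1 h2
  have := hconst.deriv.deriv_eq
  simp only [deriv_const', hd2] at this
  exact hpos.ne' this

end Calculus

section LagrangianAngle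

open Matrix

variable {ι : Type*} [Fintype ι] [DecidableEq ι]

/-- Jacobi's formula for the derivative of a determinant. -/
lemma hasDerivAt_det {𝕜 : Type*} [NontriviallyNormedField 𝕜] [NormedAlgebra ℝ 𝕜]
    {A : ℝ → Matrix ι ι 𝕜} {A' : Matrix ι ι 𝕜} {t : ℝ}
    (hA : ∀ i j, HasDerivAt (fun s => A s i j) (A' i j) t) :
    HasDerivAt (fun s => (A s).det) (((A t).adjugate * A').trace) t := by
  have key : ((A t).adjugate * A').trace =
      ∑ σ : Equiv.Perm ι, ((Equiv.Perm.sign σ : ℤ) : 𝕜) *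
        ∑ i, (∏ j ∈ Finset.univ.erase i, A t (σ j) j) • A' (σ i) i := by
    have h1 (i : ι) : ((A t).adjugate * A') i i = ((A t).updateCol i (A'.col i)).det := by
      rw [← cramer_apply, cramer_eq_adjugate_mulVec]
      rfl
    simp only [trace, diag_apply, h1, det_apply', Finset.mul_sum]
    rw [Finset.sum_comm]
    refine Finset.sum_congr rfl fun σ _ => Finset.sum_congr rfl fun i _ => ?_
    rw [← Finset.prod_erase_mul _ _ (Finset.mem_univ i)]
    congr 1
    rw [smul_eq_mul]
    congr 1
    · refine Finset.prod_congr rfl fun j hj => ?_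
      rw [updateCol_ne (Finset.ne_of_mem_erase hj)]
    · simp
  rw [key]
  simp only [det_apply']
  refine HasDerivAt.fun_sum fun σ _ => HasDerivAt.const_mul _ ?_
  exact HasDerivAt.fun_finsetProd fun i _ => hA (σ i) i

lemma I_sub_ofReal_eq_exp_arctan (a : ℝ) :
    Complex.I - a = -(Complex.exp (2 * Complex.I * Real.arctan a) * (-Complex.I - a)) := by
  have hs := Real.cos_sq_arctan a
  have ht : Real.sin (Real.arctan a) = a * Real.cos (Real.arctan a) := by
    have := Real.tan_mul_cos (Real.cos_arctan_pos a).ne'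
    rw [Real.tan_arctan] at this
    exact this.symm
  set c := Real.cos (Real.arctan a) with hc
  have hc2 : c ^ 2 * (1 + a ^ 2) = 1 := by
    rw [hs]
    field_simp
  have hexp : Complex.exp (2 * Complex.I * Real.arctan a) = (c + a * c * Complex.I) ^ 2 := by
    rw [show 2 * Complex.I * (Real.arctan a : ℂ) = (2 : ℕ) * (Real.arctan a * Complex.I) by
      push_cast; ring, Complex.exp_nat_mul, Complex.exp_mul_I, ← Complex.ofReal_cos,
      ← Complex.ofReal_sin, ht, ← hc]
    push_cast
    ring
  have hc2' : (c : ℂ) ^ 2 * (1 + (a : ℂ) ^ 2) = 1 := by exact_mod_cast hc2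
  rw [hexp]
  have hI := Complex.I_sq
  linear_combination (-(Complex.I - a)) * hc2' -
    (c ^ 2 * (a ^ 2 * Complex.I + 2 * a + a ^ 3)) * hI

lemma det_scalar_sub_map {A : Matrix ι ι ℝ} (hA : A.IsHermitian) (z : ℂ) :
    (scalar ι z - A.map Complex.ofReal).det = ∏ i, (z - hA.eigenvalues i) := by
  have h := eval_charpoly (A.map Complex.ofRealHom) z
  rw [charpoly_map, hA.charpoly_eq, Polynomial.map_prod, Polynomial.eval_prod] at h
  rw [show A.map Complex.ofReal = A.map Complex.ofRealHom from rfl, ← h]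
  simp

lemma det_scalar_I_sub {A : Matrix ι ι ℝ} (hA : A.IsHermitian) :
    (scalar ι Complex.I - A.map Complex.ofReal).det =
      (-1) ^ Fintype.card ι *
        Complex.exp (2 * Complex.I * (∑ i, Real.arctan (hA.eigenvalues i) : ℝ)) *
        (scalar ι (-Complex.I) - A.map Complex.ofReal).det := by
  rw [det_scalar_sub_map hA, det_scalar_sub_map hA]
  rw [Complex.ofReal_sum, Finset.mul_sum, Complex.exp_sum, ← Finset.card_univ, ← Finset.prod_const,
    ← Finset.prod_mul_distrib, ← Finset.prod_mul_distrib]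
  refine Finset.prod_congr rfl fun i _ => ?_
  rw [I_sub_ofReal_eq_exp_arctan]
  ring

lemma det_scalar_sub_ne_zero {A : Matrix ι ι ℝ} (hA : A.IsHermitian) {z : ℂ} (hz : z.im ≠ 0) :
    (scalar ι z - A.map Complex.ofReal).det ≠ 0 := by
  rw [det_scalar_sub_map hA, Finset.prod_ne_zero_iff]
  intro i _ h
  apply hz
  simpa using congrArg Complex.im h

lemma posDef_one_add_sq {A : Matrix ι ι ℝ} (hA : A.IsHermitian) : (1 + A * A).PosDef := by
  refine PosDef.one.add_posSemidef ?_
  have := posSemidef_conjTranspose_mul_self A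
  rwa [hA.eq] at this

/-- Derivative of the Lagrangian angle along a curve of symmetric matrices. -/
lemma deriv_angle {A : ℝ → Matrix ι ι ℝ} {A' : Matrix ι ι ℝ} {θ : ℝ → ℝ} {θ' t : ℝ}
    (hA : ∀ i j, HasDerivAt (fun s => A s i j) (A' i j) t)
    (hθ : HasDerivAt θ θ' t)
    (h : ∀ᶠ s in 𝓝 t, ∃ hs : (A s).IsHermitian, ∑ i, Real.arctan (hs.eigenvalues i) = θ s) :
    θ' = ((1 + A t * A t)⁻¹ * A').trace := by
  obtain ⟨ht, -⟩ := h.self_of_nhds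
  set P : ℂ → ℝ → Matrix ι ι ℂ := fun z s => scalar ι z - (A s).map Complex.ofReal with hP
  set D : Matrix ι ι ℂ := A'.map Complex.ofReal with hD
  have hPd (z : ℂ) : HasDerivAt (fun s => (P z s).det) (((P z t).adjugate * -D).trace) t := by
    refine hasDerivAt_det fun i j => ?_
    simpa [P, D, sub_eq_add_neg] using ((hA i j).ofReal_comp.neg.const_add (scalar ι z i j))
  have hPn (z : ℂ) (hz : z.im ≠ 0) : (P z t).det ≠ 0 := det_scalar_sub_ne_zero ht hz
  have htr (z : ℂ) (hz : z.im ≠ 0) :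
      ((P z t).adjugate * -D).trace = (P z t).det * -((P z t)⁻¹ * D).trace := by
    rw [inv_def, Ring.inverse_eq_inv']
    simp [hPn z hz]
  have hexp : HasDerivAt (fun s => (-1) ^ Fintype.card ι * Complex.exp (2 * Complex.I * (θ s : ℂ)))
      ((-1) ^ Fintype.card ι * (Complex.exp (2 * Complex.I * (θ t : ℂ)) *
        (2 * Complex.I * θ'))) t :=
    ((hθ.ofReal_comp.const_mul (2 * Complex.I)).cexp).const_mul _
  have heq : (fun s => (P Complex.I s).det) =ᶠ[𝓝 t] fun s =>
      ((-1) ^ Fintype.card ι * Complex.exp (2 * Complex.I * (θ s : ℂ))) *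
        (P (-Complex.I) s).det := by
    filter_upwards [h] with s ⟨hs, hs'⟩
    rw [← hs']
    exact det_scalar_I_sub hs
  have hder := ((hPd Complex.I).congr_of_eventuallyEq heq.symm).unique
    (hexp.mul (hPd (-Complex.I)))
  have h0 := heq.self_of_nhds
  simp only at h0
  rw [htr _ (by simp), htr _ (by simp), h0] at hder
  set E := (-1 : ℂ) ^ Fintype.card ι * Complex.exp (2 * Complex.I * (θ t : ℂ)) with hE
  have hne : E * (P (-Complex.I) t).det ≠ 0 := by
    rw [← h0]
    exact hPn _ (by simp)
  have hlog : 2 * Complex.I * θ' =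
      ((P (-Complex.I) t)⁻¹ * D).trace - ((P Complex.I t)⁻¹ * D).trace := by
    apply mul_left_cancel₀ hne
    linear_combination -hder
  set G : Matrix ι ι ℝ := (1 + A t * A t)⁻¹
  have hu : IsUnit (1 + A t * A t).det :=
    (isUnit_iff_isUnit_det _).1 (posDef_one_add_sq ht).isUnit
  set B : Matrix ι ι ℂ := (A t).map Complex.ofReal with hB
  set GC : Matrix ι ι ℂ := G.map Complex.ofReal with hGC
  have hmap (M N : Matrix ι ι ℝ) : (M * N).map Complex.ofReal =
      M.map Complex.ofReal * N.map Complex.ofReal := Matrix.map_mul (f := Complex.ofRealHom)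
  have hG : (1 + B * B) * GC = 1 := by
    have := congrArg (fun M : Matrix ι ι ℝ => M.map Complex.ofReal) (mul_nonsing_inv _ hu)
    simp only [hmap] at this
    rw [Matrix.map_add _ (by simp), hmap] at this
    simpa using this
  have hsc (z : ℂ) : P z t = z • (1 : Matrix ι ι ℂ) - B := by
    simp [P, B, smul_one_eq_diagonal]
  have hfac : P Complex.I t * P (-Complex.I) t = 1 + B * B := by
    simp only [hsc]
    simp [sub_mul, mul_sub, smul_sub, smul_smul]
  have hfac' : P (-Complex.I) t * P Complex.I t = 1 + B * B := by
    simp only [hsc]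
    simp [sub_mul, mul_sub, smul_sub, smul_smul]
    abel
  have hi1 : (P (-Complex.I) t)⁻¹ = P Complex.I t * GC := by
    apply inv_eq_right_inv
    rw [← mul_assoc, hfac', hG]
  have hi2 : (P Complex.I t)⁻¹ = P (-Complex.I) t * GC := by
    apply inv_eq_right_inv
    rw [← mul_assoc, hfac, hG]
  have hfin : ((P (-Complex.I) t)⁻¹ * D).trace - ((P Complex.I t)⁻¹ * D).trace =
      2 * Complex.I * (GC * D).trace := by
    rw [hi1, hi2, ← trace_sub, ← sub_mul, ← sub_mul, hsc, hsc, sub_sub_sub_cancel_right,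
      ← sub_smul]
    simp only [sub_neg_eq_add, smul_mul_assoc, one_mul, trace_smul, smul_eq_mul]
    ring
  rw [hfin, ← hmap] at hlog
  have h3 := mul_left_cancel₀ (by simp) hlog
  have h4 : ((G * A').map Complex.ofReal).trace = (((G * A').trace : ℝ) : ℂ) := by
    simp [trace]
  rw [h4] at h3
  exact_mod_cast h3

end LagrangianAngle

section MaximumPrinciple

variable {n : ℕ} {Ω : Set (EuclideanSpace ℝ (Fin n))}
  {G : EuclideanSpace ℝ (Fin n) → Matrix (Fin n) (Fin n) ℝ}
  {b : EuclideanSpace ℝ (Fin n) → Fin n → ℝ}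
  {f g : EuclideanSpace ℝ (Fin n) → ℝ} {x : EuclideanSpace ℝ (Fin n)}

/-- The linear operator `f ↦ Gⁱʲ ∂ᵢⱼ f - bⁱ ∂ᵢ f`. -/
noncomputable def linOp (G : EuclideanSpace ℝ (Fin n) → Matrix (Fin n) (Fin n) ℝ)
    (b : EuclideanSpace ℝ (Fin n) → Fin n → ℝ) (f : EuclideanSpace ℝ (Fin n) → ℝ)
    (x : EuclideanSpace ℝ (Fin n)) : ℝ :=
  ∑ i, ∑ j, G x i j * pd2 f i j x - ∑ i, b x i * pd f i x

lemma linOp_add_const_mul (hf : ContDiffOn ℝ ∞ f Ω) (hg : ContDiffOn ℝ ∞ g Ω) (hΩ : IsOpen Ω)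
    (hx : x ∈ Ω) (c : ℝ) :
    linOp G b (fun y => f y + c * g y) x = linOp G b f x + c * linOp G b g x := by
  have hgx := hg.differentiableAt_of_mem hΩ hx
  have h1 (i : Fin n) : pd (fun y => f y + c * g y) i x = pd f i x + c * pd g i x := by
    rw [pd_add i (hf.differentiableAt_of_mem hΩ hx) (hgx.const_mul c), pd_const_mul i c hgx]
  simp only [linOp, h1, pd2_add_const_mul hf hg hΩ hx, mul_add, Finset.sum_add_distrib,
    mul_sub, Finset.mul_sum, mul_left_comm]
  ring

lemma IsLocalMax.linOp_nonpos (hf : ContDiffOn ℝ ∞ f Ω) (hΩ : IsOpen Ω) (hx : x ∈ Ω)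
    (h : IsLocalMax f x) (hG : (G x).PosSemidef) : linOp G b f x ≤ 0 := by
  obtain ⟨m, v, hv⟩ := Matrix.posSemidef_iff_eq_sum_vecMulVec.1 hG
  have hGij (i j : Fin n) : G x i j = ∑ k, v k i * v k j := by
    rw [hv, Matrix.sum_apply]
    simp [Matrix.vecMulVec_apply]
  have hsum : ∑ i, ∑ j, G x i j * pd2 f i j x =
      ∑ k, ∑ i, ∑ j, v k i * v k j * pd2 f i j x := by
    simp only [hGij, Finset.sum_mul]
    rw [Finset.sum_comm]
    rw [Finset.sum_comm (s := Finset.univ (α := Fin m))]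
    rw [Finset.sum_comm]
    exact Finset.sum_congr rfl fun i _ => Finset.sum_comm
  simp only [linOp, h.pd_eq_zero, mul_zero, Finset.sum_const_zero, sub_zero, hsum]
  exact Finset.sum_nonpos fun k _ => h.sum_pd2_nonpos hf hΩ hx (WithLp.toLp 2 (v k))

lemma contDiff_sum_sq (y : EuclideanSpace ℝ (Fin n)) :
    ContDiff ℝ ∞ (fun z : EuclideanSpace ℝ (Fin n) => ∑ k, (z k - y k) ^ 2) :=
  ContDiff.sum fun k _ => ((contDiff_coord k).sub contDiff_const).pow 2

lemma pd_sum_sq (y : EuclideanSpace ℝ (Fin n)) (i : Fin n) :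
    pd (fun z : EuclideanSpace ℝ (Fin n) => ∑ k, (z k - y k) ^ 2) i x = 2 * (x i - y i) := by
  have hd (k : Fin n) : DifferentiableAt ℝ (fun z : EuclideanSpace ℝ (Fin n) => z k - y k) x := by
    fun_prop
  have hk (k : Fin n) : pd (fun z : EuclideanSpace ℝ (Fin n) => z k - y k) i x =
      if i = k then 1 else 0 := by
    rw [pd_sub i (by fun_prop) (by fun_prop), pd_coord, pd_const, sub_zero]
  simp only [sq]
  rw [pd_sum (F := fun k z => (z k - y k) * (z k - y k)) _ _ fun k _ => (hd k).fun_mul (hd k)]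
  simp only [pd_mul i (hd _) (hd _), hk]
  simp [Finset.sum_add_distrib]
  ring

lemma contDiff_gaussian (y : EuclideanSpace ℝ (Fin n)) (α : ℝ) :
    ContDiff ℝ ∞
      (fun z : EuclideanSpace ℝ (Fin n) => Real.exp (-α * ∑ k, (z k - y k) ^ 2)) :=
  (contDiff_const.mul (contDiff_sum_sq y)).exp

lemma linOp_gaussian (y : EuclideanSpace ℝ (Fin n)) (α : ℝ) :
    linOp G b (fun z => Real.exp (-α * ∑ k, (z k - y k) ^ 2)) x =
      2 * α * Real.exp (-α * ∑ k, (x k - y k) ^ 2) *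
        (2 * α * ∑ i, ∑ j, G x i j * ((x i - y i) * (x j - y j)) -
          (∑ i, G x i i - ∑ i, b x i * (x i - y i))) := by
  set h : EuclideanSpace ℝ (Fin n) → ℝ := fun z => Real.exp (-α * ∑ k, (z k - y k) ^ 2)
  have hh : Differentiable ℝ h := (contDiff_gaussian y α).differentiable (by simp)
  have h1 (i : Fin n) (z : EuclideanSpace ℝ (Fin n)) :
      pd h i z = h z * (-2 * α * (z i - y i)) := by
    have hq : DifferentiableAt ℝ
        (fun z : EuclideanSpace ℝ (Fin n) => ∑ k, (z k - y k) ^ 2) z :=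
      (contDiff_sum_sq y).differentiable (by simp) z
    rw [pd_exp i (hq.const_mul _), pd_const_mul i _ hq, pd_sum_sq]
    ring
  have h2 (i j : Fin n) : pd2 h i j x =
      h x * (4 * α ^ 2 * ((x i - y i) * (x j - y j)) - if i = j then 2 * α else 0) := by
    have hd : DifferentiableAt ℝ (fun z : EuclideanSpace ℝ (Fin n) => z j - y j) x := by fun_prop
    have hj : pd (fun z : EuclideanSpace ℝ (Fin n) => z j - y j) i x =
        if i = j then 1 else 0 := by
      rw [pd_sub i (by fun_prop) (by fun_prop), pd_coord, pd_const, sub_zero]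
    simp only [pd2, h1 j]
    rw [pd_mul i (hh x) (hd.const_mul _), pd_const_mul i _ hd, hj, h1]
    split_ifs <;> ring
  have e1 (i : Fin n) : ∑ j, G x i j * pd2 h i j x = h x *
      (4 * α ^ 2 * ∑ j, G x i j * ((x i - y i) * (x j - y j)) - 2 * α * G x i i) := by
    have hj (j : Fin n) : G x i j * pd2 h i j x =
        h x * (4 * α ^ 2 * (G x i j * ((x i - y i) * (x j - y j)))) -
          if i = j then h x * (2 * α * G x i i) else 0 := by
      rw [h2]
      split_ifs with e
      · subst e
        ring
      · ring
    simp only [hj, Finset.sum_sub_distrib, ← Finset.mul_sum, Finset.sum_ite_eq,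
      Finset.mem_univ, if_true]
    ring
  have e2 : ∑ i, b x i * pd h i x = h x * (-2 * α) * ∑ i, b x i * (x i - y i) := by
    simp only [h1, Finset.mul_sum]
    exact Finset.sum_congr rfl fun j _ => by ring
  rw [linOp, e2]
  simp only [e1]
  rw [← Finset.mul_sum, Finset.sum_sub_distrib, ← Finset.mul_sum, ← Finset.mul_sum]
  ring

lemma exists_linOp_gaussian_pos (hGc : ∀ i j, ContinuousOn (fun x => G x i j) Ω)
    (hbc : ∀ i, ContinuousOn (fun x => b x i) Ω) (hG : ∀ x ∈ Ω, (G x).PosDef)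
    {K : Set (EuclideanSpace ℝ (Fin n))} (hK : IsCompact K) (hKΩ : K ⊆ Ω)
    {y : EuclideanSpace ℝ (Fin n)} (hy : y ∉ K) :
    ∃ α > 0, ∀ x ∈ K, 0 < linOp G b (fun z => Real.exp (-α * ∑ k, (z k - y k) ^ 2)) x := by
  set Q : EuclideanSpace ℝ (Fin n) → ℝ :=
    fun x => ∑ i, ∑ j, G x i j * ((x i - y i) * (x j - y j)) with hQ
  set T : EuclideanSpace ℝ (Fin n) → ℝ :=
    fun x => ∑ i, G x i i - ∑ i, b x i * (x i - y i) with hT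
  have hQpos : ∀ x ∈ K, 0 < Q x := by
    intro x hx
    have hne : (fun i => x i - y i) ≠ 0 := by
      intro h0
      apply hy
      have : x = y := by
        ext i
        simpa [sub_eq_zero] using congrFun h0 i
      exact this ▸ hx
    have := (hG x (hKΩ hx)).dotProduct_mulVec_pos hne
    simp only [dotProduct, Matrix.mulVec, Finset.mul_sum, Pi.star_apply, star_trivial] at this
    exact this.trans_eq (Finset.sum_congr rfl fun i _ => Finset.sum_congr rfl fun j _ => by ring)
  have hQc : ContinuousOn Q K := by
    refine continuousOn_finsetSum _ fun i _ => continuousOn_finsetSum _ fun j _ => ?_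
    exact ((hGc i j).mono hKΩ).mul (by fun_prop)
  have hTc : ContinuousOn T K := by
    refine (continuousOn_finsetSum _ fun i _ => (hGc i i).mono hKΩ).sub
      (continuousOn_finsetSum _ fun i _ => ?_)
    exact ((hbc i).mono hKΩ).mul (by fun_prop)
  obtain ⟨C, hC⟩ := (hK.image_of_continuousOn
    (hTc.div hQc fun x hx => (hQpos x hx).ne')).bddAbove
  refine ⟨max C 0 + 1, by positivity, fun x hx => ?_⟩
  rw [linOp_gaussian]
  have h1 : T x / Q x ≤ C := hC ⟨x, hx, rfl⟩
  rw [div_le_iff₀ (hQpos x hx)] at h1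
  have h2 : C ≤ max C 0 := le_max_left _ _
  have h3 : 0 ≤ max C 0 := le_max_right _ _
  have h4 := hQpos x hx
  have h5 : 0 < 2 * (max C 0 + 1) * Q x - T x := by
    nlinarith [mul_le_mul_of_nonneg_right h2 h4.le, mul_nonneg h3 h4.le]
  exact mul_pos (by positivity) h5

lemma sum_sub_sq_eq (z y : EuclideanSpace ℝ (Fin n)) :
    ∑ k, (z k - y k) ^ 2 = dist z y ^ 2 := by
  rw [EuclideanSpace.dist_eq, Real.sq_sqrt (Finset.sum_nonneg fun i _ => sq_nonneg _)]
  exact Finset.sum_congr rfl fun k _ => by rw [Real.dist_eq, sq_abs]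

/-- A subsolution cannot touch its maximum for the first time at a point of a sphere. -/
lemma false_of_touching_ball (hΩ : IsOpen Ω) (hGc : ∀ i j, ContinuousOn (fun x => G x i j) Ω)
    (hbc : ∀ i, ContinuousOn (fun x => b x i) Ω) (hG : ∀ x ∈ Ω, (G x).PosDef)
    {w : EuclideanSpace ℝ (Fin n) → ℝ} (hw : ContDiffOn ℝ ∞ w Ω)
    (hLw : ∀ x ∈ Ω, 0 ≤ linOp G b w x) {x₀ y : EuclideanSpace ℝ (Fin n)} (hx₀ : x₀ ∈ Ω)
    (hmax : ∀ x ∈ Ω, w x ≤ w x₀) (hne : x₀ ≠ y)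
    (hlt : ∀ x ∈ Ω, dist x y ≤ dist x₀ y → x ≠ x₀ → w x < w x₀) : False := by
  have hR : 0 < dist x₀ y := dist_pos.2 hne
  obtain ⟨ρ, hρ, hρΩ⟩ := Metric.isOpen_iff.1 hΩ x₀ hx₀
  set r := min (ρ / 2) (dist x₀ y / 2) with hr
  have hr0 : 0 < r := by positivity
  have hrR : r < dist x₀ y := (min_le_right _ _).trans_lt (by linarith)
  have hKΩ : Metric.closedBall x₀ r ⊆ Ω :=
    (Metric.closedBall_subset_ball ((min_le_left _ _).trans_lt (by linarith))).trans hρΩ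
  have hyK : y ∉ Metric.closedBall x₀ r := by
    rw [Metric.mem_closedBall, dist_comm]
    exact not_le.2 hrR
  obtain ⟨α, hα, hpos⟩ :=
    exists_linOp_gaussian_pos hGc hbc hG (isCompact_closedBall x₀ r) hKΩ hyK
  set h : EuclideanSpace ℝ (Fin n) → ℝ := fun z => Real.exp (-α * ∑ k, (z k - y k) ^ 2) with hh
  have hhs : ContDiff ℝ ∞ h := contDiff_gaussian y α
  have hh1 (z) : h z ≤ 1 := by
    rw [hh]
    simp only [sum_sub_sq_eq]
    exact Real.exp_le_one_iff.2 (by nlinarith [sq_nonneg (dist z y)])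
  have hh0 (z) : 0 < h z := Real.exp_pos _
  have hhlt (z) (hz : dist x₀ y < dist z y) : h z < h x₀ := by
    simp only [hh, sum_sub_sq_eq]
    refine Real.exp_lt_exp.2 ?_
    nlinarith [mul_pos hα (by nlinarith : 0 < dist z y ^ 2 - dist x₀ y ^ 2)]
  have hTc : IsCompact (Metric.sphere x₀ r ∩ Metric.closedBall y (dist x₀ y)) :=
    (isCompact_sphere x₀ r).inter_right Metric.isClosed_closedBall
  obtain ⟨ε, hε, hεT⟩ : ∃ ε > 0, ∀ z ∈ Metric.sphere x₀ r ∩ Metric.closedBall y (dist x₀ y),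
      w z ≤ w x₀ - ε := by
    rcases (Metric.sphere x₀ r ∩ Metric.closedBall y (dist x₀ y)).eq_empty_or_nonempty with hT | hT
    · exact ⟨1, one_pos, by simp [hT]⟩
    · have hTΩ : Metric.sphere x₀ r ∩ Metric.closedBall y (dist x₀ y) ⊆ Ω :=
        inter_subset_left.trans (Metric.sphere_subset_closedBall.trans hKΩ)
      obtain ⟨p, hp, hpm⟩ := hTc.exists_isMaxOn hT (hw.continuousOn.mono hTΩ)
      refine ⟨w x₀ - w p, sub_pos.2 (hlt p (hTΩ hp) hp.2 ?_), fun z hz => ?_⟩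
      · rintro rfl
        simpa [hr0.ne] using hp.1
      · linarith [isMaxOn_iff.1 hpm z hz]
  set δ := ε / 2 with hδ
  have hδ0 : 0 < δ := by positivity
  have hfs : ContDiffOn ℝ ∞ (fun z => w z + δ * h z) Ω :=
    hw.add (contDiffOn_const.mul hhs.contDiffOn)
  obtain ⟨p, hp, hpm⟩ := (isCompact_closedBall x₀ r).exists_isMaxOn
    ⟨x₀, Metric.mem_closedBall_self hr0.le⟩ (hfs.continuousOn.mono hKΩ)
  have hp0 := isMaxOn_iff.1 hpm x₀ (Metric.mem_closedBall_self hr0.le)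
  have hpr : dist p x₀ < r := by
    refine lt_of_le_of_ne hp fun hpe => ?_
    rcases le_or_gt (dist p y) (dist x₀ y) with hle | hgt
    · have := hεT p ⟨hpe, hle⟩
      have h1 := mul_le_mul_of_nonneg_left (hh1 p) hδ0.le
      have h2 := mul_pos hδ0 (hh0 x₀)
      linarith
    · have h1 := mul_lt_mul_of_pos_left (hhlt p hgt) hδ0
      have h2 := hmax p (hKΩ hp)
      linarith
  have hloc : IsLocalMax (fun z => w z + δ * h z) p :=
    hpm.isLocalMax (Filter.mem_of_superset (Metric.isOpen_ball.mem_nhds hpr)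
      Metric.ball_subset_closedBall)
  have h1 := hloc.linOp_nonpos (b := b) hfs hΩ (hKΩ hp) (hG p (hKΩ hp)).posSemidef
  rw [linOp_add_const_mul hw hhs.contDiffOn hΩ (hKΩ hp)] at h1
  have h2 := mul_pos hδ0 (hpos p hp)
  linarith [hLw p (hKΩ hp)]

/-- The strong maximum principle of Hopf. -/
theorem strong_maximum_principle (hΩ : IsOpen Ω) (hΩc : IsPreconnected Ω)
    (hGc : ∀ i j, ContinuousOn (fun x => G x i j) Ω)
    (hbc : ∀ i, ContinuousOn (fun x => b x i) Ω) (hG : ∀ x ∈ Ω, (G x).PosDef)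
    {w : EuclideanSpace ℝ (Fin n) → ℝ} (hw : ContDiffOn ℝ ∞ w Ω)
    (hLw : ∀ x ∈ Ω, 0 ≤ linOp G b w x) {p : EuclideanSpace ℝ (Fin n)} (hp : p ∈ Ω)
    (hmax : ∀ x ∈ Ω, w x ≤ w p) : ∀ x ∈ Ω, w x = w p := by
  have hopen : ∀ x₁ ∈ Ω, w x₁ = w p → ∀ᶠ y in 𝓝 x₁, w y = w p := by
    intro x₁ hx₁ hwx₁
    obtain ⟨ρ, hρ, hρΩ⟩ := Metric.isOpen_iff.1 hΩ x₁ hx₁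
    refine Metric.eventually_nhds_iff.2 ⟨ρ / 4, by positivity, fun y hy => ?_⟩
    by_contra hwy
    have hBΩ : Metric.closedBall x₁ (ρ / 2) ⊆ Ω :=
      (Metric.closedBall_subset_ball (by linarith)).trans hρΩ
    have hFc : IsCompact (Metric.closedBall x₁ (ρ / 2) ∩ w ⁻¹' {w p}) :=
      (isCompact_closedBall x₁ (ρ / 2)).of_isClosed_subset
        ((hw.continuousOn.mono hBΩ).preimage_isClosed_of_isClosed Metric.isClosed_closedBall
          isClosed_singleton) inter_subset_left
    obtain ⟨x₀, ⟨hx₀B, hx₀w⟩, hx₀m⟩ := hFc.exists_isMinOn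
      ⟨x₁, Metric.mem_closedBall_self (by positivity), hwx₁⟩
      (f := fun z => dist z y) (by fun_prop)
    have hx₀w : w x₀ = w p := hx₀w
    have hRle : dist x₀ y ≤ dist x₁ y :=
      isMinOn_iff.1 hx₀m x₁ ⟨Metric.mem_closedBall_self (by positivity), hwx₁⟩
    rw [dist_comm] at hy
    have hlt : ∀ z ∈ Ω, dist z y < dist x₀ y → w z < w x₀ := by
      intro z hz hzy
      rw [hx₀w]
      refine lt_of_le_of_ne (hmax z hz) fun hzw => ?_
      have hzB : z ∈ Metric.closedBall x₁ (ρ / 2) := by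
        have := dist_triangle z y x₁
        rw [dist_comm y x₁] at this
        exact Metric.mem_closedBall.2 (by linarith)
      exact absurd hzy (not_lt.2 (isMinOn_iff.1 hx₀m z ⟨hzB, hzw⟩))
    have hne : x₀ ≠ y := fun h => hwy (h ▸ hx₀w)
    set c := midpoint ℝ x₀ y with hc
    have hcx : dist x₀ c = dist x₀ y / 2 := by
      rw [hc, dist_left_midpoint]
      norm_num
      ring
    have hcy : dist c y = dist x₀ y / 2 := by
      rw [hc, dist_midpoint_right]
      norm_num
      ring
    refine false_of_touching_ball hΩ hGc hbc hG hw hLw (hBΩ hx₀B) (y := c)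
      (fun x hx => hx₀w ▸ hmax x hx) ?_ fun z hz hzc hzx => hlt z hz ?_
    · rw [← dist_pos, hcx]
      exact half_pos (dist_pos.2 hne)
    · by_contra! hge
      apply hzx
      have hpar := parallelogram_law_with_norm ℝ (z - c) (c - y)
      have h1 : z - c + (c - y) = z - y := by abel
      have h2 : z - c - (c - y) = z - x₀ := by
        have : x₀ + y = c + c := (midpoint_add_self ℝ x₀ y).symm
        rw [eq_sub_of_add_eq this]
        abel
      rw [h1, h2, ← dist_eq_norm, ← dist_eq_norm, ← dist_eq_norm, ← dist_eq_norm, hcy] at hpar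
      rw [hcx] at hzc
      have h3 : dist z x₀ * dist z x₀ ≤ 0 := by
        nlinarith [mul_self_le_mul_self dist_nonneg hge, mul_self_le_mul_self dist_nonneg hzc]
      exact dist_eq_zero.1 (mul_self_eq_zero.1 (le_antisymm h3 (mul_self_nonneg _)))
  have hF : IsOpen {x ∈ Ω | w x = w p} := by
    rw [isOpen_iff_mem_nhds]
    rintro x ⟨hx, hwx⟩
    filter_upwards [hΩ.mem_nhds hx, hopen x hx hwx] with y h1 h2 using ⟨h1, h2⟩
  have hF' : IsOpen (Ω ∩ w ⁻¹' {w p}ᶜ) :=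
    hw.continuousOn.isOpen_inter_preimage hΩ isOpen_compl_singleton
  have hsub : Ω ⊆ {x ∈ Ω | w x = w p} := by
    refine hΩc.subset_left_of_subset_union hF hF' ?_ ?_ ⟨p, hp, hp, rfl⟩
    · rw [Set.disjoint_left]
      exact fun x h1 h2 => h2.2 h1.2
    · intro x hx
      by_cases h : w x = w p
      · exact Or.inl ⟨hx, h⟩
      · exact Or.inr ⟨hx, h⟩
  exact fun x hx => (hsub hx).2

end MaximumPrinciple

section Shrinker

variable {n : ℕ} {Ω : Set (EuclideanSpace ℝ (Fin n))} {u : EuclideanSpace ℝ (Fin n) → ℝ}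
  {x : EuclideanSpace ℝ (Fin n)}

/-- The shrinker potential `(1/2) x·∇u − u`. -/
noncomputable def shrinkerPotential (u : EuclideanSpace ℝ (Fin n) → ℝ)
    (x : EuclideanSpace ℝ (Fin n)) : ℝ :=
  (1 / 2) * (∑ i, x i * pd u i x) - u x

/-- The squared length `|x|² + |∇u|²` of the position vector of the gradient graph. -/
noncomputable def graphNormSq (u : EuclideanSpace ℝ (Fin n) → ℝ)
    (x : EuclideanSpace ℝ (Fin n)) : ℝ :=
  ∑ i, (x i * x i + pd u i x * pd u i x)

/-- The inverse `(1 + (D²u)²)⁻¹` of the induced metric of the gradient graph. -/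
noncomputable def invMetric (u : EuclideanSpace ℝ (Fin n) → ℝ)
    (x : EuclideanSpace ℝ (Fin n)) : Matrix (Fin n) (Fin n) ℝ :=
  (1 + hessM u x * hessM u x)⁻¹

/-- The potential equation of Lagrangian shrinkers on `Ω`. -/
def IsShrinkerPotentialOn (u : EuclideanSpace ℝ (Fin n) → ℝ)
    (Ω : Set (EuclideanSpace ℝ (Fin n))) : Prop :=
  ∀ x ∈ Ω, ∀ h : (hessM u x).IsHermitian,
    ∑ i, Real.arctan (h.eigenvalues i) = shrinkerPotential u x

lemma contDiffOn_pd2 (hu : ContDiffOn ℝ ∞ u Ω) (hΩ : IsOpen Ω) (i j : Fin n) :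
    ContDiffOn ℝ ∞ (pd2 u i j) Ω :=
  (hu.pd hΩ j).pd hΩ i

lemma isHermitian_hessM (hu : ContDiffOn ℝ ∞ u Ω) (hΩ : IsOpen Ω) (hx : x ∈ Ω) :
    (hessM u x).IsHermitian := by
  ext i j
  simpa [hessM] using pd2_comm hu hΩ hx j i

lemma posDef_invMetric (hu : ContDiffOn ℝ ∞ u Ω) (hΩ : IsOpen Ω) (hx : x ∈ Ω) :
    (invMetric u x).PosDef :=
  (posDef_one_add_sq (isHermitian_hessM hu hΩ hx)).inv

lemma isUnit_det_metric (hu : ContDiffOn ℝ ∞ u Ω) (hΩ : IsOpen Ω) (hx : x ∈ Ω) :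
    IsUnit (1 + hessM u x * hessM u x).det :=
  (Matrix.isUnit_iff_isUnit_det _).1 (posDef_one_add_sq (isHermitian_hessM hu hΩ hx)).isUnit

lemma continuousOn_invMetric (hu : ContDiffOn ℝ ∞ u Ω) (hΩ : IsOpen Ω) (i j : Fin n) :
    ContinuousOn (fun x => invMetric u x i j) Ω := by
  have hH : ContinuousOn (hessM u) Ω :=
    continuousOn_pi.2 fun i => continuousOn_pi.2 fun j => (contDiffOn_pd2 hu hΩ i j).continuousOn
  have hg : ContinuousOn (fun x => 1 + hessM u x * hessM u x) Ω :=
    (continuous_const.add (continuous_id.matrix_mul continuous_id)).comp_continuousOn hH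
  have hdet : ContinuousOn (fun x => (1 + hessM u x * hessM u x).det) Ω :=
    (continuous_id.matrix_det (n := Fin n)).comp_continuousOn hg
  have hadj : ContinuousOn (fun x => (1 + hessM u x * hessM u x).adjugate i j) Ω :=
    ((continuous_id.matrix_adjugate (n := Fin n)).matrix_elem i j).comp_continuousOn hg
  have := (hdet.inv₀ fun x hx => (isUnit_det_metric hu hΩ hx).ne_zero).mul hadj
  refine this.congr fun x _ => ?_
  simp [invMetric, Matrix.inv_def, Ring.inverse_eq_inv']

lemma contDiffOn_shrinkerPotential (hu : ContDiffOn ℝ ∞ u Ω) (hΩ : IsOpen Ω) :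
    ContDiffOn ℝ ∞ (shrinkerPotential u) Ω :=
  (contDiffOn_const.mul (ContDiffOn.sum fun i _ =>
    (contDiff_coord i).contDiffOn.mul (hu.pd hΩ i))).sub hu

lemma contDiffOn_graphNormSq (hu : ContDiffOn ℝ ∞ u Ω) (hΩ : IsOpen Ω) :
    ContDiffOn ℝ ∞ (graphNormSq u) Ω :=
  ContDiffOn.sum fun i _ =>
    ((contDiff_coord i).mul (contDiff_coord i)).contDiffOn.add ((hu.pd hΩ i).mul (hu.pd hΩ i))

lemma pd_shrinkerPotential (hu : ContDiffOn ℝ ∞ u Ω) (hΩ : IsOpen Ω) (hx : x ∈ Ω) (l : Fin n) :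
    pd (shrinkerPotential u) l x = (1 / 2) * ∑ j, x j * pd2 u l j x - (1 / 2) * pd u l x := by
  have hc (j : Fin n) : DifferentiableAt ℝ (fun y : EuclideanSpace ℝ (Fin n) => y j) x := by
    fun_prop
  have hp (j : Fin n) : DifferentiableAt ℝ (pd u j) x :=
    (hu.pd hΩ j).differentiableAt_of_mem hΩ hx
  have hs : DifferentiableAt ℝ (fun y : EuclideanSpace ℝ (Fin n) => ∑ j, y j * pd u j y) x :=
    DifferentiableAt.fun_sum fun j _ => (hc j).fun_mul (hp j)
  unfold shrinkerPotential
  rw [pd_sub l (hs.const_mul _) (hu.differentiableAt_of_mem hΩ hx), pd_const_mul l _ hs,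
    pd_sum (F := fun j y => y j * pd u j y) _ _ fun j _ => (hc j).fun_mul (hp j)]
  simp only [pd_mul l (hc _) (hp _), pd_coord, Finset.sum_add_distrib, mul_ite, mul_one, mul_zero,
    Finset.sum_ite_eq, Finset.mem_univ, if_true, pd2]
  ring

lemma pd_pd2_swap (hu : ContDiffOn ℝ ∞ u Ω) (hΩ : IsOpen Ω) (hx : x ∈ Ω) (j k l : Fin n) :
    pd (pd2 u l j) k x = pd (pd2 u l k) j x := by
  rw [pd_congr hΩ hx (fun y hy => pd2_comm hu hΩ hy l j) k,
    pd_congr hΩ hx (fun y hy => pd2_comm hu hΩ hy l k) j]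
  exact pd2_comm (hu.pd hΩ l) hΩ hx k j

lemma pd2_shrinkerPotential (hu : ContDiffOn ℝ ∞ u Ω) (hΩ : IsOpen Ω) (hx : x ∈ Ω)
    (k l : Fin n) :
    pd2 (shrinkerPotential u) k l x = (1 / 2) * ∑ j, x j * pd (pd2 u l k) j x := by
  have hc (j : Fin n) : DifferentiableAt ℝ (fun y : EuclideanSpace ℝ (Fin n) => y j) x := by
    fun_prop
  have hp (j : Fin n) : DifferentiableAt ℝ (pd2 u l j) x :=
    (contDiffOn_pd2 hu hΩ l j).differentiableAt_of_mem hΩ hx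
  have hs : DifferentiableAt ℝ (fun y : EuclideanSpace ℝ (Fin n) => ∑ j, y j * pd2 u l j y) x :=
    DifferentiableAt.fun_sum fun j _ => (hc j).fun_mul (hp j)
  have hl : DifferentiableAt ℝ (pd u l) x := (hu.pd hΩ l).differentiableAt_of_mem hΩ hx
  rw [pd2, pd_congr hΩ hx (fun y hy => pd_shrinkerPotential hu hΩ hy l),
    pd_sub k (hs.const_mul _) (hl.const_mul _), pd_const_mul k _ hs, pd_const_mul k _ hl,
    pd_sum (F := fun j y => y j * pd2 u l j y) _ _ fun j _ => (hc j).fun_mul (hp j)]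
  simp only [pd_mul k (hc _) (hp _), pd_coord, Finset.sum_add_distrib, mul_ite, mul_one, mul_zero,
    Finset.sum_ite_eq, Finset.mem_univ, if_true, pd_pd2_swap hu hΩ hx _ k l]
  rw [pd2_comm hu hΩ hx l k, pd2]
  ring

lemma pd_graphNormSq (hu : ContDiffOn ℝ ∞ u Ω) (hΩ : IsOpen Ω) (hx : x ∈ Ω) (l : Fin n) :
    pd (graphNormSq u) l x = 2 * x l + 2 * ∑ m, pd u m x * pd2 u l m x := by
  have hc (j : Fin n) : DifferentiableAt ℝ (fun y : EuclideanSpace ℝ (Fin n) => y j) x := by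
    fun_prop
  have hp (j : Fin n) : DifferentiableAt ℝ (pd u j) x :=
    (hu.pd hΩ j).differentiableAt_of_mem hΩ hx
  unfold graphNormSq
  rw [pd_sum (F := fun j y => y j * y j + pd u j y * pd u j y) _ _ fun j _ =>
    ((hc j).fun_mul (hc j)).fun_add ((hp j).fun_mul (hp j))]
  simp only [pd_add l ((hc _).fun_mul (hc _)) ((hp _).fun_mul (hp _)), pd_mul l (hc _) (hc _),
    pd_mul l (hp _) (hp _), pd_coord, Finset.sum_add_distrib, mul_ite, mul_one, mul_zero,
    Finset.sum_ite_eq, Finset.mem_univ, if_true, pd2]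
  ring

lemma pd2_graphNormSq (hu : ContDiffOn ℝ ∞ u Ω) (hΩ : IsOpen Ω) (hx : x ∈ Ω) (k l : Fin n) :
    pd2 (graphNormSq u) k l x =
      2 * (1 + hessM u x * hessM u x) l k + 2 * ∑ m, pd u m x * pd (pd2 u l k) m x := by
  have hc (j : Fin n) : DifferentiableAt ℝ (fun y : EuclideanSpace ℝ (Fin n) => y j) x := by
    fun_prop
  have hp (j : Fin n) : DifferentiableAt ℝ (pd u j) x :=
    (hu.pd hΩ j).differentiableAt_of_mem hΩ hx
  have hpp (j : Fin n) : DifferentiableAt ℝ (pd2 u l j) x :=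
    (contDiffOn_pd2 hu hΩ l j).differentiableAt_of_mem hΩ hx
  have hs : DifferentiableAt ℝ (fun y => ∑ m, pd u m y * pd2 u l m y) x :=
    DifferentiableAt.fun_sum fun j _ => (hp j).fun_mul (hpp j)
  rw [pd2, pd_congr hΩ hx (fun y hy => pd_graphNormSq hu hΩ hy l),
    pd_add k ((hc l).const_mul _) (hs.const_mul _), pd_const_mul k _ hs, pd_const_mul k _ (hc l),
    pd_sum (F := fun m y => pd u m y * pd2 u l m y) _ _ fun j _ => (hp j).fun_mul (hpp j)]
  simp only [pd_mul k (hp _) (hpp _), pd_coord, Finset.sum_add_distrib,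
    pd_pd2_swap hu hΩ hx _ k l, Matrix.add_apply, Matrix.one_apply, Matrix.mul_apply, hessM,
    Matrix.of_apply, pd2_comm hu hΩ hx _ k]
  simp only [eq_comm (a := k) (b := l), pd2]
  ring

lemma pd_shrinkerPotential_eq_trace (hu : ContDiffOn ℝ ∞ u Ω) (hΩ : IsOpen Ω)
    (heq : IsShrinkerPotentialOn u Ω) (hx : x ∈ Ω) (m : Fin n) :
    pd (shrinkerPotential u) m x = ∑ k, ∑ l, invMetric u x k l * pd (pd2 u l k) m x := by
  set v : EuclideanSpace ℝ (Fin n) := EuclideanSpace.single m 1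
  have h0 : x + (0 : ℝ) • v = x := by simp
  have hline {f : EuclideanSpace ℝ (Fin n) → ℝ} (hf : ContDiffOn ℝ ∞ f Ω) :
      HasDerivAt (fun s : ℝ => f (x + s • v)) (pd f m x) 0 := by
    have h := hasDerivAt_line (x := x) v 0
      (by rw [h0]; exact hf.differentiableAt_of_mem hΩ hx)
    rwa [h0, ← fderiv_apply_eq_sum_pd] at h
  have hmem : ∀ᶠ s : ℝ in 𝓝 0, x + s • v ∈ Ω := by
    have hc : Continuous fun s : ℝ => x + s • v := by fun_prop
    exact hc.continuousAt.eventually_mem (by rw [h0]; exact hΩ.mem_nhds hx)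
  have key := deriv_angle (A := fun s => hessM u (x + s • v))
    (A' := Matrix.of fun i j => pd (pd2 u i j) m x)
    (fun i j => hline (contDiffOn_pd2 hu hΩ i j))
    (hline (contDiffOn_shrinkerPotential hu hΩ)) (by
      filter_upwards [hmem] with s hs
      exact ⟨isHermitian_hessM hu hΩ hs, heq _ hs _⟩)
  rw [key, h0]
  simp [Matrix.trace, Matrix.mul_apply, invMetric]

lemma linOp_shrinkerPotential (hu : ContDiffOn ℝ ∞ u Ω) (hΩ : IsOpen Ω)
    (heq : IsShrinkerPotentialOn u Ω) (hx : x ∈ Ω) :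
    linOp (invMetric u) (fun y i => y i / 2) (shrinkerPotential u) x = 0 := by
  rw [linOp, sub_eq_zero]
  simp only [pd2_shrinkerPotential hu hΩ hx, pd_shrinkerPotential_eq_trace hu hΩ heq hx,
    Finset.mul_sum]
  conv_rhs => rw [Finset.sum_comm]
  refine Finset.sum_congr rfl fun k _ => ?_
  conv_rhs => rw [Finset.sum_comm]
  exact Finset.sum_congr rfl fun l _ => Finset.sum_congr rfl fun j _ => by ring

lemma linOp_graphNormSq (hu : ContDiffOn ℝ ∞ u Ω) (hΩ : IsOpen Ω)
    (heq : IsShrinkerPotentialOn u Ω) (hx : x ∈ Ω) :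
    linOp (invMetric u) (fun y i => y i / 2) (graphNormSq u) x = 2 * n - graphNormSq u x := by
  have h1 : ∑ k, ∑ l, invMetric u x k l * (1 + hessM u x * hessM u x) l k = n := by
    have := congrArg Matrix.trace (Matrix.nonsing_inv_mul _ (isUnit_det_metric hu hΩ hx))
    simpa [Matrix.trace, Matrix.mul_apply, invMetric] using this
  have h2 : ∑ k, ∑ l, invMetric u x k l * ∑ m, pd u m x * pd (pd2 u l k) m x =
      ∑ m, pd u m x * pd (shrinkerPotential u) m x := by
    simp only [pd_shrinkerPotential_eq_trace hu hΩ heq hx, Finset.mul_sum]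
    conv_rhs => rw [Finset.sum_comm]
    refine Finset.sum_congr rfl fun k _ => ?_
    conv_rhs => rw [Finset.sum_comm]
    exact Finset.sum_congr rfl fun l _ => Finset.sum_congr rfl fun j _ => by ring
  have h3 : ∑ k, ∑ l, invMetric u x k l * pd2 (graphNormSq u) k l x =
      2 * n + 2 * ∑ m, pd u m x * pd (shrinkerPotential u) m x := by
    rw [← h1, ← h2]
    simp only [pd2_graphNormSq hu hΩ hx, mul_add, Finset.sum_add_distrib, mul_left_comm _ (2 : ℝ),
      ← Finset.mul_sum]
  have h4 : ∑ m, pd u m x * ∑ j, x j * pd2 u m j x =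
      ∑ i, x i * ∑ m, pd u m x * pd2 u i m x := by
    simp only [Finset.mul_sum]
    rw [Finset.sum_comm]
    refine Finset.sum_congr rfl fun i _ => Finset.sum_congr rfl fun m _ => ?_
    rw [pd2_comm hu hΩ hx m i]
    ring
  have h5 : ∑ m, pd u m x * pd (shrinkerPotential u) m x =
      (1 / 2) * ∑ i, x i * ∑ m, pd u m x * pd2 u i m x - (1 / 2) * ∑ m, pd u m x * pd u m x := by
    rw [← h4]
    simp only [pd_shrinkerPotential hu hΩ hx, mul_sub, Finset.sum_sub_distrib,
      mul_left_comm _ (1 / 2 : ℝ), ← Finset.mul_sum]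
  have h6 : ∑ i, x i / 2 * pd (graphNormSq u) i x =
      ∑ i, x i * x i + ∑ i, x i * ∑ m, pd u m x * pd2 u i m x := by
    rw [← Finset.sum_add_distrib]
    refine Finset.sum_congr rfl fun i _ => ?_
    rw [pd_graphNormSq hu hΩ hx]
    ring
  rw [linOp, h3, h5, h6, graphNormSq, Finset.sum_add_distrib]
  ring

lemma abs_shrinkerPotential_le (hu : ContDiffOn ℝ ∞ u Ω) (hΩ : IsOpen Ω)
    (heq : IsShrinkerPotentialOn u Ω) (hx : x ∈ Ω) :
    |shrinkerPotential u x| ≤ n * (Real.pi / 2) := by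
  rw [← heq x hx (isHermitian_hessM hu hΩ hx)]
  refine (Finset.abs_sum_le_sum_abs _ _).trans ?_
  refine (Finset.sum_le_card_nsmul _ _ (Real.pi / 2) fun i _ => ?_).trans (by simp)
  exact abs_le.2 ⟨(Real.neg_pi_div_two_lt_arctan _).le, (Real.arctan_lt_pi_div_two _).le⟩

lemma isCompact_sublevel_graphNormSq (hu : ContDiffOn ℝ ∞ u Ω) (hΩ : IsOpen Ω)
    (hbd : ∀ z ∈ frontier Ω,
      Tendsto (fun x => Real.sqrt (∑ i, (pd u i x) ^ 2)) (𝓝[Ω] z) atTop) (c : ℝ) :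
    IsCompact {x ∈ Ω | graphNormSq u x ≤ c} := by
  have hsplit (x) : graphNormSq u x = ∑ i, x i ^ 2 + ∑ i, pd u i x ^ 2 := by
    simp only [graphNormSq, sq, Finset.sum_add_distrib]
  refine Metric.isCompact_of_isClosed_isBounded ?_ ?_
  · refine isClosed_of_closure_subset fun z hz => ?_
    have hne : (𝓝[{x ∈ Ω | graphNormSq u x ≤ c}] z).NeBot := mem_closure_iff_nhdsWithin_neBot.1 hz
    have hle : 𝓝[{x ∈ Ω | graphNormSq u x ≤ c}] z ≤ 𝓝[Ω] z := nhdsWithin_mono _ fun x hx => hx.1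
    have hzΩ : z ∈ Ω := by
      by_contra hzΩ
      have hfr : z ∈ frontier Ω := by
        rw [hΩ.frontier_eq]
        exact ⟨closure_mono (fun x hx => hx.1) hz, hzΩ⟩
      have h1 := ((hbd z hfr).mono_left hle).eventually_gt_atTop (Real.sqrt c)
      obtain ⟨x, hx1, hx2⟩ := (h1.and self_mem_nhdsWithin).exists
      refine absurd hx1 (not_lt.2 (Real.sqrt_le_sqrt ?_))
      have := hsplit x ▸ hx2.2
      linarith [Finset.sum_nonneg fun (i : Fin n) (_ : i ∈ Finset.univ) => sq_nonneg (x i)]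
    refine ⟨hzΩ, ?_⟩
    have hcont := ((contDiffOn_graphNormSq hu hΩ).continuousOn z hzΩ).tendsto.mono_left hle
    exact le_of_tendsto hcont (eventually_mem_nhdsWithin.mono fun x hx => hx.2)
  · refine (Metric.isBounded_closedBall (x := (0 : EuclideanSpace ℝ (Fin n)))
      (r := Real.sqrt c)).subset fun x hx => ?_
    rw [mem_closedBall_zero_iff, EuclideanSpace.norm_eq]
    refine Real.sqrt_le_sqrt ?_
    have := hsplit x ▸ hx.2
    simp only [Real.norm_eq_abs, sq_abs]
    linarith [Finset.sum_nonneg fun (i : Fin n) (_ : i ∈ Finset.univ) => sq_nonneg (pd u i x)]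

/-- Since `|X|²` is proper and satisfies `L|X|² = 2n - |X|²`, the penalized angle `Θ - ε|X|²`
attains its maximum, and does so in `{|X|² ≤ 2n}`. -/
lemma exists_penalized_max (hu : ContDiffOn ℝ ∞ u Ω) (hΩ : IsOpen Ω) (hne : Ω.Nonempty)
    (heq : IsShrinkerPotentialOn u Ω)
    (hbd : ∀ z ∈ frontier Ω,
      Tendsto (fun x => Real.sqrt (∑ i, (pd u i x) ^ 2)) (𝓝[Ω] z) atTop) {ε : ℝ} (hε : 0 < ε) :
    ∃ p ∈ Ω, graphNormSq u p ≤ 2 * n ∧ ∀ x ∈ Ω,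
      shrinkerPotential u x - ε * graphNormSq u x ≤
        shrinkerPotential u p - ε * graphNormSq u p := by
  obtain ⟨q, hq⟩ := hne
  set B : ℝ := n * (Real.pi / 2)
  set c : ℝ := graphNormSq u q + 2 * B / ε with hc
  have hB : 0 ≤ B := by positivity
  have hqc : graphNormSq u q ≤ c := le_add_of_nonneg_right (by positivity)
  have hfs : ContDiffOn ℝ ∞ (fun x => shrinkerPotential u x + -ε * graphNormSq u x) Ω :=
    (contDiffOn_shrinkerPotential hu hΩ).add
      (contDiffOn_const.mul (contDiffOn_graphNormSq hu hΩ))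
  obtain ⟨p, ⟨hpΩ, -⟩, hpm⟩ := (isCompact_sublevel_graphNormSq hu hΩ hbd c).exists_isMaxOn
    ⟨q, hq, hqc⟩ (hfs.continuousOn.mono fun x hx => hx.1)
  have hpm := isMaxOn_iff.1 hpm
  have hmax : ∀ x ∈ Ω, shrinkerPotential u x + -ε * graphNormSq u x ≤
      shrinkerPotential u p + -ε * graphNormSq u p := by
    intro x hx
    by_cases hxc : graphNormSq u x ≤ c
    · exact hpm x ⟨hx, hxc⟩
    · have h1 := hpm q ⟨hq, hqc⟩
      have h2 : shrinkerPotential u x ≤ B := (abs_le.1 (abs_shrinkerPotential_le hu hΩ heq hx)).2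
      have h3 : -B ≤ shrinkerPotential u q := (abs_le.1 (abs_shrinkerPotential_le hu hΩ heq hq)).1
      have h4 := mul_lt_mul_of_pos_left (not_le.1 hxc) hε
      rw [hc, mul_add, mul_div_cancel₀ _ hε.ne'] at h4
      linarith
  refine ⟨p, hpΩ, ?_, fun x hx => by linarith [hmax x hx]⟩
  have hloc : IsLocalMax (fun x => shrinkerPotential u x + -ε * graphNormSq u x) p :=
    Filter.mem_of_superset (hΩ.mem_nhds hpΩ) hmax
  have hL := hloc.linOp_nonpos (G := invMetric u) (b := fun y i => y i / 2) hfs hΩ hpΩ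
    (posDef_invMetric hu hΩ hpΩ).posSemidef
  rw [linOp_add_const_mul (contDiffOn_shrinkerPotential hu hΩ) (contDiffOn_graphNormSq hu hΩ)
    hΩ hpΩ, linOp_shrinkerPotential hu hΩ heq hpΩ, linOp_graphNormSq hu hΩ heq hpΩ] at hL
  by_contra! h
  nlinarith

lemma exists_max_shrinkerPotential (hu : ContDiffOn ℝ ∞ u Ω) (hΩ : IsOpen Ω) (hne : Ω.Nonempty)
    (heq : IsShrinkerPotentialOn u Ω)
    (hbd : ∀ z ∈ frontier Ω,
      Tendsto (fun x => Real.sqrt (∑ i, (pd u i x) ^ 2)) (𝓝[Ω] z) atTop) :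
    ∃ p ∈ Ω, ∀ x ∈ Ω, shrinkerPotential u x ≤ shrinkerPotential u p := by
  obtain ⟨q, hq, hq2, -⟩ := exists_penalized_max hu hΩ hne heq hbd one_pos
  obtain ⟨p, ⟨hp, -⟩, hpm⟩ := (isCompact_sublevel_graphNormSq hu hΩ hbd (2 * n)).exists_isMaxOn
    ⟨q, hq, hq2⟩ ((contDiffOn_shrinkerPotential hu hΩ).continuousOn.mono fun x hx => hx.1)
  have hnonneg (y) : 0 ≤ graphNormSq u y :=
    Finset.sum_nonneg fun i _ => add_nonneg (mul_self_nonneg _) (mul_self_nonneg _)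
  refine ⟨p, hp, fun x hx => le_of_forall_pos_le_add fun η hη => ?_⟩
  have hx1 : 0 < graphNormSq u x + 1 := add_pos_of_nonneg_of_pos (hnonneg x) one_pos
  obtain ⟨y, hy, hy2, hym⟩ := exists_penalized_max hu hΩ hne heq hbd (div_pos hη hx1)
  have h1 := hym x hx
  have h2 := isMaxOn_iff.1 hpm y ⟨hy, hy2⟩
  have h3 : 0 ≤ η / (graphNormSq u x + 1) * graphNormSq u y :=
    mul_nonneg (div_pos hη hx1).le (hnonneg y)
  have h4 : η / (graphNormSq u x + 1) * graphNormSq u x ≤ η := by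
    rw [div_mul_eq_mul_div, div_le_iff₀ hx1]
    nlinarith
  linarith

end Shrinker

end Helpers

/-- For a solution `u` of the Lagrangian shrinker potential equation
`∑ arctan λᵢ(D²u) = (1/2) x·∇u − u` on a nonempty open connected `Ω ⊆ ℝⁿ` with
`‖∇u‖ → ∞` at every boundary point of `Ω`, the Lagrangian angle
`Θ = (1/2) x·∇u − u` is constant on `Ω`. -/
theorem lagrangian_angle_constant
    (n : ℕ) (hn : 1 ≤ n) (Ω : Set (EuclideanSpace ℝ (Fin n)))
    (hΩne : Ω.Nonempty) (hΩo : IsOpen Ω) (hΩc : IsConnected Ω)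
    (u : EuclideanSpace ℝ (Fin n) → ℝ)
    (hu : ContDiffOn ℝ (⊤ : ℕ∞) u Ω)
    (heq : ∀ x ∈ Ω, ∀ h : (hessM u x).IsHermitian,
      ∑ i, Real.arctan (h.eigenvalues i)
        = (1 / 2) * (∑ i, x i * pd u i x) - u x)
    (hbd : ∀ z ∈ frontier Ω,
      Filter.Tendsto (fun x => Real.sqrt (∑ i, (pd u i x) ^ 2))
        (nhdsWithin z Ω) Filter.atTop) :
    ∃ c : ℝ, ∀ x ∈ Ω, (1 / 2) * (∑ i, x i * pd u i x) - u x = c := by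
  obtain ⟨p, hp, hmax⟩ := exists_max_shrinkerPotential hu hΩo hΩne heq hbd
  exact ⟨shrinkerPotential u p, strong_maximum_principle (b := fun y i => y i / 2) hΩo
    hΩc.isPreconnected (continuousOn_invMetric hu hΩo) (fun i => by fun_prop)
    (fun x hx => posDef_invMetric hu hΩo hx) (contDiffOn_shrinkerPotential hu hΩo)
    (fun x hx => (linOp_shrinkerPotential hu hΩo heq hx).ge) hp hmax⟩
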